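/- Let k ∈ ℕ and let A be a k-minimal unital C*-algebra. If ρ: A → ℂ is a pure state, then the GNS representation of ρ acts on a Hilbert space of dimension at most k; that is, there exist a Hilbert space H with dim H ≤ k, a unital *-homomorphism π: A → B(H), and a unit vector ξ ∈ H cyclic for π(A) such that ρ(a) = ⟨π(a)ξ, ξ⟩ for all a ∈ A. -/

import Mathlib

open scoped ComplexConjugate ComplexOrder

noncomputable section

universe u v

/-- The diagonal matrix `I_n ⊗ e` in `M_n(V)`. -/
def unitMat {V : Type u} [AddCommGroup V] (n : ℕ) (e : V) : Matrix (Fin n) (Fin n) V :=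
  Matrix.of fun i j => if i = j then e else 0

/-- The conjugation `α* x α ∈ M_m(V)` of `x ∈ M_n(V)` by a scalar matrix `α ∈ M_{n,m}(ℂ)`. -/
def conjAct {V : Type u} [AddCommGroup V] [Module ℂ V] {n m : ℕ}
    (α : Matrix (Fin n) (Fin m) ℂ) (x : Matrix (Fin n) (Fin n) V) :
    Matrix (Fin m) (Fin m) V :=
  Matrix.of fun i j => ∑ p : Fin n, ∑ q : Fin n, (conj (α p i) * α q j) • x p q

section Defs

variable {V : Type u} [AddCommGroup V] [Module ℂ V] [StarAddMonoid V] [StarModule ℂ V]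

/-- `(V, C, e)` is a `k`-AOU space. -/
structure IsKAOU (k : ℕ) (C : Set (Matrix (Fin k) (Fin k) V)) (e : V) : Prop where
  herm : ∀ x ∈ C, star x = x
  add_mem : ∀ x ∈ C, ∀ y ∈ C, x + y ∈ C
  smul_mem : ∀ r : ℝ, 0 ≤ r → ∀ x ∈ C, (r : ℂ) • x ∈ C
  proper : ∀ x ∈ C, -x ∈ C → x = 0
  compat : ∀ α : Matrix (Fin k) (Fin k) ℂ, ∀ x ∈ C, conjAct α x ∈ C
  orderUnit : ∀ x : Matrix (Fin k) (Fin k) V, star x = x →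
    ∃ r : ℝ, 0 < r ∧ (r : ℂ) • unitMat k e - x ∈ C
  arch : ∀ x : Matrix (Fin k) (Fin k) V,
    (∀ r : ℝ, 0 < r → x + (r : ℂ) • unitMat k e ∈ C) → x ∈ C

/-- A matrix ordering on the `*`-vector space `V`. -/
structure IsMatrixOrdering (C : ∀ n : ℕ, Set (Matrix (Fin n) (Fin n) V)) : Prop where
  herm : ∀ n, ∀ x ∈ C n, star x = x
  add_mem : ∀ n, ∀ x ∈ C n, ∀ y ∈ C n, x + y ∈ C n
  smul_mem : ∀ n, ∀ r : ℝ, 0 ≤ r → ∀ x ∈ C n, (r : ℂ) • x ∈ C n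
  proper : ∀ n, ∀ x ∈ C n, -x ∈ C n → x = 0
  compat : ∀ n m : ℕ, ∀ α : Matrix (Fin n) (Fin m) ℂ, ∀ x ∈ C n, conjAct α x ∈ C m

/-- `(V, {C_n}, e)` is an (abstract) operator system. -/
structure IsOperatorSystem (C : ∀ n : ℕ, Set (Matrix (Fin n) (Fin n) V)) (e : V)
    extends IsMatrixOrdering C : Prop where
  orderUnit : ∀ n : ℕ, ∀ x : Matrix (Fin n) (Fin n) V, star x = x →
    ∃ r : ℝ, 0 < r ∧ (r : ℂ) • unitMat n e - x ∈ C n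
  arch : ∀ n : ℕ, ∀ x : Matrix (Fin n) (Fin n) V,
    (∀ r : ℝ, 0 < r → x + (r : ℂ) • unitMat n e ∈ C n) → x ∈ C n

/-- The cones `C_n^{k-min}` associated to a `k`-AOU space `(V, C, e)`. -/
def kMinCone (k : ℕ) (C : Set (Matrix (Fin k) (Fin k) V)) (n : ℕ) :
    Set (Matrix (Fin n) (Fin n) V) :=
  {x | star x = x ∧ ∀ α : Matrix (Fin n) (Fin k) ℂ, conjAct α x ∈ C}

/-- `{𝒞_n}` is an extension of the `k`-AOU space `(V, C, e)`: a matrix ordering with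
`𝒞_k = C` making `(V, {𝒞_n}, e)` an operator system. -/
def IsExtension (k : ℕ) (C : Set (Matrix (Fin k) (Fin k) V)) (e : V)
    (𝒞 : ∀ n : ℕ, Set (Matrix (Fin n) (Fin n) V)) : Prop :=
  IsOperatorSystem 𝒞 e ∧ 𝒞 k = C

end Defs

/-- A state on a unital complex `*`-algebra `B`: a linear functional with `ρ(1) = 1` and
`ρ(b* b) ≥ 0` for all `b`. -/
def IsStateCstar {B : Type v} [Ring B] [StarRing B] [Algebra ℂ B]
    (ρ : B →ₗ[ℂ] ℂ) : Prop :=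
  ρ 1 = 1 ∧ ∀ b : B, 0 ≤ ρ (star b * b)

/-- A pure state on a unital complex `*`-algebra `B`: an extreme point of the set of
states. -/
def IsPureStateCstar {B : Type v} [Ring B] [StarRing B] [Algebra ℂ B]
    (ρ : B →ₗ[ℂ] ℂ) : Prop :=
  IsStateCstar ρ ∧
    ∀ ψ₁ ψ₂ : B →ₗ[ℂ] ℂ, IsStateCstar ψ₁ → IsStateCstar ψ₂ →
      ∀ t : ℝ, 0 < t → t < 1 → ρ = (t : ℂ) • ψ₁ + ((1 - t : ℝ) : ℂ) • ψ₂ →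
        ψ₁ = ρ ∧ ψ₂ = ρ

/-- `x ∈ M_n(A)` is positive: it is of the form `y* y`. -/
def MatPos {A : Type v} [Ring A] [StarRing A] {n : ℕ}
    (x : Matrix (Fin n) (Fin n) A) : Prop :=
  ∃ y : Matrix (Fin n) (Fin n) A, x = star y * y

/-- A unital complex `*`-algebra `A` is `k`-minimal if a self-adjoint `x ∈ M_n(A)` is
positive whenever all its compressions `α* x α ∈ M_k(A)` by scalar matrices
`α ∈ M_{n,k}(ℂ)` are positive. -/
def IsKMinimalCstar (A : Type v) [Ring A] [StarRing A] [Algebra ℂ A] (k : ℕ) : Prop :=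
  ∀ (n : ℕ) (x : Matrix (Fin n) (Fin n) A), star x = x →
    (∀ α : Matrix (Fin n) (Fin k) ℂ, MatPos (conjAct α x)) → MatPos x

section PureStates

variable {A : Type v} [CStarAlgebra A]

/-- A functional dominated by a pure state is a multiple of it. -/
theorem IsPureStateCstar.eq_smul_of_le {ρ : A →ₗ[ℂ] ℂ} (hρ : IsPureStateCstar ρ)
    {φ : A →ₗ[ℂ] ℂ} (hpos : ∀ b, 0 ≤ φ (star b * b)) (hle : ∀ b, φ (star b * b) ≤ ρ (star b * b)) :
    φ = φ 1 • ρ := by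
  have h1 := hρ.1.1
  have h0 : 0 ≤ φ 1 := by simpa using hpos 1
  have h0' : φ 1 ≤ 1 := by simpa [h1] using hle 1
  obtain ⟨t, ht⟩ : ∃ t : ℝ, φ 1 = t := ⟨(φ 1).re, Complex.eq_re_of_ofReal_le (r := 0) (by simpa)⟩
  rw [ht] at h0 h0' ⊢
  replace h0 : 0 ≤ t := by exact_mod_cast h0
  replace h0' : t ≤ 1 := by exact_mod_cast h0'
  have ht1 : (t : ℂ) + 1 ≠ 0 := by exact_mod_cast (by linarith : t + 1 ≠ 0)
  have ht2 : (2 : ℂ) - t ≠ 0 := by exact_mod_cast (by linarith : 2 - t ≠ 0)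
  have hs1 : (0 : ℂ) ≤ ((t : ℂ) + 1)⁻¹ := by
    exact_mod_cast (by positivity : (0 : ℝ) ≤ (t + 1)⁻¹)
  have hs2 : (0 : ℂ) ≤ ((2 : ℂ) - t)⁻¹ := by
    exact_mod_cast (inv_nonneg.2 (by linarith) : (0 : ℝ) ≤ (2 - t)⁻¹)
  have key := (hρ.2 (((t : ℂ) + 1)⁻¹ • (φ + ρ)) (((2 : ℂ) - t)⁻¹ • ((2 : ℂ) • ρ - φ))
    ⟨by simp [ht, h1]; field_simp, fun b => mul_nonneg hs1 (add_nonneg (hpos b) (hρ.1.2 b))⟩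
    ⟨by simp [ht, h1, ht2], fun b => mul_nonneg hs2 (sub_nonneg.2 ((hle b).trans (by
      simpa [two_mul] using hρ.1.2 b)))⟩ ((t + 1) / 3) (by linarith) (by linarith) (by
      ext a
      simp only [LinearMap.add_apply, LinearMap.smul_apply, LinearMap.sub_apply, smul_eq_mul]
      push_cast
      have : (1 : ℂ) - (t + 1) / 3 = (2 - t) / 3 := by ring
      rw [this]
      field_simp
      ring)).1
  ext a
  have := LinearMap.congr_fun key a
  simp only [LinearMap.add_apply, LinearMap.smul_apply, smul_eq_mul] at this ⊢
  field_simp at this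
  linear_combination this

variable [PartialOrder A] [StarOrderedRing A]

/-- The positive linear map underlying a state. -/
def IsStateCstar.toPositive {ρ : A →ₗ[ℂ] ℂ} (hρ : IsStateCstar ρ) : A →ₚ[ℂ] ℂ :=
  PositiveLinearMap.mk₀ ρ fun a ha => by
    obtain ⟨b, rfl⟩ := CStarAlgebra.nonneg_iff_eq_star_mul_self.1 ha
    exact hρ.2 b

@[simp]
theorem IsStateCstar.toPositive_apply {ρ : A →ₗ[ℂ] ℂ} (hρ : IsStateCstar ρ) (a : A) :
    hρ.toPositive a = ρ a := rfl

theorem IsStateCstar.map_nonneg {ρ : A →ₗ[ℂ] ℂ} (hρ : IsStateCstar ρ) {a : A} (ha : 0 ≤ a) :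
    0 ≤ ρ a := _root_.map_nonneg hρ.toPositive ha

theorem IsStateCstar.re_mono {ρ : A →ₗ[ℂ] ℂ} (hρ : IsStateCstar ρ) {a b : A} (h : a ≤ b) :
    (ρ a).re ≤ (ρ b).re := by
  have := (Complex.le_def.1 (hρ.map_nonneg (sub_nonneg.2 h))).1
  simpa using this

theorem IsStateCstar.ofReal_re {ρ : A →ₗ[ℂ] ℂ} (hρ : IsStateCstar ρ) {a : A}
    (ha : IsSelfAdjoint a) : ((ρ a).re : ℂ) = ρ a := by
  have : star (ρ a) = ρ a := by
    rw [← hρ.toPositive_apply, ← map_star hρ.toPositive, ha.star_eq]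
  exact Complex.conj_eq_iff_re.1 this

/-- Real version of domination: a positive real functional on the self-adjoint part that is
dominated by a pure state is a multiple of it. -/
theorem IsPureStateCstar.exists_eq_mul_re {ρ : A →ₗ[ℂ] ℂ} (hρ : IsPureStateCstar ρ)
    (ψ : selfAdjoint A →ₗ[ℝ] ℝ) (hpos : ∀ a : selfAdjoint A, 0 ≤ (a : A) → 0 ≤ ψ a)
    (hle : ∀ a : selfAdjoint A, 0 ≤ (a : A) → ψ a ≤ (ρ a).re) :
    ∀ a : selfAdjoint A, ψ a = ψ 1 * (ρ a).re := by
  let φ : A →ₗ[ℂ] ℂ := Module.Dual.extendRCLike (ψ ∘ₗ realPart)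
  have hφ : ∀ a : selfAdjoint A, φ a = ψ a := fun a => by
    simp [φ, Module.Dual.extendRCLike_apply, realPart_I_smul]
  have key := hρ.eq_smul_of_le (φ := φ)
    (fun b => by
      have := hφ ⟨star b * b, .star_mul_self b⟩
      simp only at this
      rw [this]
      exact_mod_cast hpos _ (star_mul_self_nonneg b))
    (fun b => by
      have := hφ ⟨star b * b, .star_mul_self b⟩
      simp only at this
      rw [this, ← hρ.1.ofReal_re (.star_mul_self b)]
      exact_mod_cast hle ⟨star b * b, .star_mul_self b⟩ (star_mul_self_nonneg b))
  intro a
  have h := LinearMap.congr_fun key a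
  have h1 := hφ 1
  simp only [selfAdjoint.val_one] at h1
  rw [LinearMap.smul_apply, hφ, h1, smul_eq_mul, ← hρ.1.ofReal_re a.2] at h
  exact_mod_cast h

/-- Finitely many self-adjoint elements with positive value at a pure state have a common lower
bound with positive value. -/
theorem IsPureStateCstar.exists_le_of_pos {ρ : A →ₗ[ℂ] ℂ} (hρ : IsPureStateCstar ρ)
    {ι : Type*} [Finite ι] [Nonempty ι] (c : ι → selfAdjoint A) (hc : ∀ i, 0 < (ρ (c i)).re) :
    ∃ h : selfAdjoint A, (∀ i, (h : A) ≤ c i) ∧ 0 < (ρ h).re := by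
  classical
  cases nonempty_fintype ι
  by_contra! hcon
  let τ : selfAdjoint A →ₗ[ℝ] ℝ :=
    Complex.reLm ∘ₗ ρ.restrictScalars ℝ ∘ₗ (selfAdjoint.submodule ℝ A).subtype
  have hτ : ∀ a, τ a = (ρ a).re := fun a => rfl
  let i₀ : ι := Classical.arbitrary ι
  let const : selfAdjoint A →ₗ[ℝ] (ι → selfAdjoint A) := LinearMap.pi fun _ => LinearMap.id
  let s : PointedCone ℝ (ι → selfAdjoint A) :=
    { carrier := {x | ∃ r : ℝ, 0 ≤ r ∧ ∀ i, (0 : A) ≤ x i + r • (c i : A)}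
      zero_mem' := ⟨0, le_rfl, by simp⟩
      add_mem' := by
        rintro x y ⟨r, hr, hx⟩ ⟨t, ht, hy⟩
        refine ⟨r + t, add_nonneg hr ht, fun i => ?_⟩
        have := add_nonneg (hx i) (hy i)
        simp only [Pi.add_apply, AddSubgroup.coe_add, add_smul]
        convert this using 1
        abel
      smul_mem' := by
        rintro ⟨t, ht⟩ x ⟨r, hr, hx⟩
        refine ⟨t * r, mul_nonneg ht hr, fun i => ?_⟩
        have := smul_nonneg ht (hx i)
        rwa [smul_add, smul_smul] at this }
  let f : (ι → selfAdjoint A) →ₗ.[ℝ] ℝ :=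
    ⟨LinearMap.range const, τ ∘ₗ LinearMap.proj i₀ ∘ₗ Submodule.subtype _⟩
  obtain ⟨g, hgf, hgs⟩ := riesz_extension s f (by
    rintro ⟨_, z, rfl⟩ ⟨r, hr, hz⟩
    change 0 ≤ τ z
    rw [hτ]
    rcases hr.eq_or_lt with rfl | hr
    · have := hρ.1.re_mono (show (0 : A) ≤ z by simpa [const] using hz i₀)
      simpa using this
    · have := hcon (-(r⁻¹ • z)) fun i => by
        have := smul_nonneg (inv_nonneg.2 hr.le) (hz i)
        rw [smul_add, smul_smul, inv_mul_cancel₀ hr.ne', one_smul] at this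
        rw [← sub_nonneg]
        simpa [const, add_comm] using this
      have h2 : 0 ≤ r⁻¹ * (ρ z).re := by
        have h3 : (ρ (((-(r⁻¹ • z) : selfAdjoint A)) : A)).re = -(r⁻¹ * (ρ z).re) := by
          rw [← hτ, ← hτ, map_neg, map_smul, smul_eq_mul]
        linarith
      exact nonneg_of_mul_nonneg_right h2 (inv_pos.2 hr)) (by
    intro y
    refine ⟨⟨const (∑ i, ‖(y i : A)‖ • 1), ⟨_, rfl⟩⟩, 0, le_rfl, fun i => ?_⟩
    have h1 : -algebraMap ℝ A ‖(y i : A)‖ ≤ y i := (y i).2.neg_algebraMap_norm_le_self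
    have h2 : algebraMap ℝ A ‖(y i : A)‖ ≤ ∑ i, algebraMap ℝ A ‖(y i : A)‖ :=
      Finset.single_le_sum (f := fun i => algebraMap ℝ A ‖(y i : A)‖)
        (fun j _ => algebraMap_nonneg _ (norm_nonneg _)) (Finset.mem_univ i)
    have h3 : (((∑ i, ‖(y i : A)‖ • (1 : selfAdjoint A) : selfAdjoint A)) : A) =
        ∑ i, algebraMap ℝ A ‖(y i : A)‖ := by
      simp [Algebra.algebraMap_eq_smul_one]
    simp only [const, Pi.add_apply, LinearMap.pi_apply, LinearMap.id_apply, zero_smul, add_zero,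
      AddSubgroup.coe_add, h3]
    have := add_le_add h2 h1
    simpa using this)
  have hgc : ∀ z, g (const z) = (ρ z).re := fun z => hgf ⟨const z, ⟨z, rfl⟩⟩
  have hgpos : ∀ x : ι → selfAdjoint A, (∀ i, (0 : A) ≤ x i) → 0 ≤ g x :=
    fun x hx => hgs x ⟨0, le_rfl, by simpa using hx⟩
  have hgneg : g c ≤ 0 := by
    have := hgs (-c) ⟨1, zero_le_one, by simp⟩
    simpa using this
  let ψ : ι → selfAdjoint A →ₗ[ℝ] ℝ := fun i => g ∘ₗ LinearMap.single ℝ (fun _ => selfAdjoint A) i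
  have hsum : ∀ x, g x = ∑ i, ψ i (x i) := fun x => by
    simp only [ψ, LinearMap.comp_apply, ← map_sum]
    congr 1
    simp [Finset.univ_sum_single]
  have hψpos : ∀ i, ∀ a : selfAdjoint A, 0 ≤ (a : A) → 0 ≤ ψ i a := fun i a ha => by
    refine hgpos _ fun j => ?_
    by_cases hj : j = i
    · subst hj; simpa
    · simp [hj]
  have hψ : ∀ i, ∀ a : selfAdjoint A, ψ i a = ψ i 1 * (ρ a).re := fun i =>
    hρ.exists_eq_mul_re (ψ i) (hψpos i) fun a ha => by
      rw [← hgc, hsum]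
      exact Finset.single_le_sum (f := fun i => ψ i a) (fun j _ => hψpos j a ha)
        (Finset.mem_univ i)
  have hψ1 : ∀ i, 0 ≤ ψ i 1 := fun i => hψpos i 1 (by simp)
  have hone : ∑ i, ψ i 1 = 1 := by
    have h1 := hgc 1
    rw [hsum] at h1
    simpa [const, hρ.1.1] using h1
  rw [hsum] at hgneg
  simp_rw [fun i => hψ i (c i)] at hgneg
  have hz := (Finset.sum_eq_zero_iff_of_nonneg
    (fun i _ => mul_nonneg (hψ1 i) (hc i).le)).1
    (le_antisymm hgneg (Finset.sum_nonneg fun i _ => mul_nonneg (hψ1 i) (hc i).le))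
  have : ∑ i, ψ i 1 = 0 := Finset.sum_eq_zero fun i hi =>
    (mul_eq_zero.1 (hz i hi)).resolve_right (hc i).ne'
  linarith

end PureStates

section Excision

variable {A : Type v} [CStarAlgebra A] [PartialOrder A] [StarOrderedRing A]

theorem IsSelfAdjoint.norm_le_of_abs_le {x : A} (hx : IsSelfAdjoint x) {r : ℝ} (hr : 0 ≤ r)
    (h₁ : -algebraMap ℝ A r ≤ x) (h₂ : x ≤ algebraMap ℝ A r) : ‖x‖ ≤ r := by
  rcases subsingleton_or_nontrivial A with _ | _
  · simpa [Subsingleton.elim x 0]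
  rw [← map_neg] at h₁
  rcases CStarAlgebra.norm_or_neg_norm_mem_spectrum hx with h | h
  · exact (le_algebraMap_iff_spectrum_le hx).1 h₂ _ h
  · linarith [(algebraMap_le_iff_le_spectrum hx).1 h₁ _ h]

/-- Approximate excision of a pure state on finitely many self-adjoint elements. -/
theorem IsPureStateCstar.exists_excision_selfAdjoint {ρ : A →ₗ[ℂ] ℂ} (hρ : IsPureStateCstar ρ)
    {ι : Type*} [Finite ι] [Nonempty ι] (a : ι → selfAdjoint A) {ε : ℝ} (hε : 0 < ε) :
    ∃ e : A, IsSelfAdjoint e ∧ ‖e‖ = 1 ∧ ∀ i, ‖e * a i * e - ρ (a i) • (e * e)‖ ≤ ε := by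
  let b : ι → selfAdjoint A := fun i => a i - (ρ (a i)).re • 1
  have hb : ∀ i, (ρ (b i)).re = 0 := fun i => by
    have : ρ ((ρ (a i)).re • (1 : A)) = (ρ (a i)).re := by
      rw [← Complex.coe_smul, map_smul, hρ.1.1]; simp
    simp [b, this]
  have hε1 : ρ (ε • (1 : A)) = ε := by
    rw [← Complex.coe_smul, map_smul, hρ.1.1]; simp
  let c : ι × Bool → selfAdjoint A := fun p => ε • 1 + (if p.2 then b p.1 else -b p.1)
  obtain ⟨h, hle, hpos⟩ := hρ.exists_le_of_pos c (fun ⟨i, s⟩ => by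
    have := hb i
    cases s <;> simp [c, hε1, this, hε])
  have hh : IsSelfAdjoint (h : A) := h.2
  have hne : (h : A)⁺ ≠ 0 := fun h0 => by
    have := hρ.1.re_mono ((CFC.posPart_eq_zero_iff (h : A) hh).1 h0)
    simp at this
    linarith
  have hn : 0 < ‖(h : A)⁺‖ := norm_pos_iff.2 hne
  have hp0 : 0 ≤ (h : A)⁺ := CFC.posPart_nonneg _
  set e : A := ‖(h : A)⁺‖⁻¹ • (h : A)⁺ with he
  have he0 : 0 ≤ e := smul_nonneg (inv_nonneg.2 hn.le) hp0
  have hesa : IsSelfAdjoint e := .of_nonneg he0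
  have hnorm : ‖e‖ = 1 := by
    rw [he, norm_smul, norm_inv, norm_norm, inv_mul_cancel₀ hn.ne']
  have hehe : 0 ≤ e * h * e := by
    have h1 : (h : A) * (h : A)⁺ = (h : A)⁺ * (h : A)⁺ := by
      have h3 := congrArg (· * (h : A)⁺) (CFC.posPart_sub_negPart (h : A) hh)
      simpa [sub_mul] using h3.symm
    have h2 : e * h * e = (‖(h : A)⁺‖⁻¹ * ‖(h : A)⁺‖⁻¹) • ((h : A)⁺ * (h : A)⁺ * (h : A)⁺) := by
      rw [he, smul_mul_assoc, smul_mul_assoc, mul_smul_comm, smul_smul, mul_assoc, h1, mul_assoc]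
    rw [h2]
    refine smul_nonneg (by positivity) ?_
    have := (IsSelfAdjoint.of_nonneg hp0).conjugate_nonneg hp0
    exact this
  have hee : e * e ≤ 1 := by
    have := CStarAlgebra.star_mul_le_algebraMap_norm_sq (a := e)
    simpa [hesa.star_eq, hnorm] using this
  have hle1 : ε • (e * e) ≤ algebraMap ℝ A ε := by
    rw [Algebra.algebraMap_eq_smul_one]
    exact smul_le_smul_of_nonneg_left hee hε.le
  have hbound : ∀ p, 0 ≤ e * c p * e := fun p =>
    hehe.trans (hesa.conjugate_le_conjugate (hle p))
  refine ⟨e, hesa, hnorm, fun i => ?_⟩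
  have heq : e * a i * e - ρ (a i) • (e * e) = e * b i * e := by
    simp only [b, AddSubgroup.coe_sub, mul_sub, sub_mul]
    rw [← hρ.1.ofReal_re (a i).2]
    simp
  have h1 := hbound (i, true)
  have h2 := hbound (i, false)
  simp only [c, if_true, AddSubgroup.coe_add, mul_add, add_mul, selfAdjoint.val_smul,
    selfAdjoint.val_one, mul_smul_comm, smul_mul_assoc, mul_one, Bool.false_eq_true, if_false,
    AddSubgroup.coe_neg, mul_neg, neg_mul] at h1 h2
  have hX : IsSelfAdjoint (e * b i * e) := by
    have := (b i).2.conjugate e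
    rwa [hesa.star_eq] at this
  rw [heq]
  refine hX.norm_le_of_abs_le hε.le ?_ ?_
  · refine le_trans (neg_le_neg hle1) (neg_le_iff_add_nonneg'.2 h1)
  · exact (le_of_sub_nonneg (by rwa [sub_eq_add_neg])).trans hle1

/-- Approximate excision of a pure state on finitely many elements. -/
theorem IsPureStateCstar.exists_excision {ρ : A →ₗ[ℂ] ℂ} (hρ : IsPureStateCstar ρ)
    {ι : Type*} [Finite ι] [Nonempty ι] (a : ι → A) {ε : ℝ} (hε : 0 < ε) :
    ∃ e : A, IsSelfAdjoint e ∧ ‖e‖ = 1 ∧ ∀ i, ‖e * a i * e - ρ (a i) • (e * e)‖ ≤ ε := by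
  obtain ⟨e, he, hn, h⟩ := hρ.exists_excision_selfAdjoint
    (fun p : ι × Bool => if p.2 then realPart (a p.1) else imaginaryPart (a p.1)) (half_pos hε)
  refine ⟨e, he, hn, fun i => ?_⟩
  have h1 := h (i, true)
  have h2 := h (i, false)
  simp only [if_true, Bool.false_eq_true, if_false] at h1 h2
  have : e * a i * e - ρ (a i) • (e * e) =
      (e * realPart (a i) * e - ρ (realPart (a i)) • (e * e)) +
        Complex.I • (e * imaginaryPart (a i) * e - ρ (imaginaryPart (a i)) • (e * e)) := by
    conv_lhs => rw [← realPart_add_I_smul_imaginaryPart (a i)]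
    simp only [map_add, map_smul, mul_add, add_mul, mul_smul_comm, smul_mul_assoc, add_smul,
      smul_sub, smul_smul, smul_eq_mul]
    abel
  rw [this]
  refine (norm_add_le _ _).trans ?_
  rw [norm_smul, Complex.norm_I, one_mul]
  linarith

end Excision

section MatrixPositivity

open scoped Matrix

theorem conjAct_eq_mul {A : Type v} [Ring A] [StarRing A] [Algebra ℂ A] [StarModule ℂ A]
    {n m : ℕ} (α : Matrix (Fin n) (Fin m) ℂ) (x : Matrix (Fin n) (Fin n) A) :
    conjAct α x = (α.map (algebraMap ℂ A))ᴴ * x * α.map (algebraMap ℂ A) := by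
  ext i j
  simp only [conjAct, Matrix.of_apply, Matrix.mul_apply, Matrix.conjTranspose_apply,
    Matrix.map_apply, Finset.sum_mul]
  rw [Finset.sum_comm]
  refine Finset.sum_congr rfl fun p _ => Finset.sum_congr rfl fun q _ => ?_
  rw [← algebraMap_star_comm, mul_assoc, ← Algebra.commutes, ← mul_assoc, ← map_mul,
    ← Algebra.smul_def]
  rfl

theorem conjAct_mul {A : Type v} [Ring A] [StarRing A] [Algebra ℂ A] [StarModule ℂ A]
    {n m l : ℕ} (α : Matrix (Fin n) (Fin m) ℂ) (β : Matrix (Fin m) (Fin l) ℂ)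
    (x : Matrix (Fin n) (Fin n) A) : conjAct (α * β) x = conjAct β (conjAct α x) := by
  simp only [conjAct_eq_mul, Matrix.map_mul, Matrix.conjTranspose_mul, Matrix.mul_assoc]

theorem MatPos.conjAct {A : Type v} [Ring A] [StarRing A] [Algebra ℂ A] [StarModule ℂ A]
    {n : ℕ} {x : Matrix (Fin n) (Fin n) A} (hx : MatPos x) (α : Matrix (Fin n) (Fin n) ℂ) :
    MatPos (conjAct α x) := by
  obtain ⟨y, rfl⟩ := hx
  refine ⟨y * α.map (algebraMap ℂ A), ?_⟩
  simp only [conjAct_eq_mul, Matrix.star_eq_conjTranspose, Matrix.conjTranspose_mul,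
    Matrix.mul_assoc]

theorem CStarAlgebra.exists_star_mul_self_add {B : Type*} [CStarAlgebra B] (a b : B) :
    ∃ c, star a * a + star b * b = star c * c := by
  let _ := CStarAlgebra.spectralOrder B
  have := CStarAlgebra.spectralOrderedRing B
  exact CStarAlgebra.nonneg_iff_eq_star_mul_self.1
    (add_nonneg (star_mul_self_nonneg a) (star_mul_self_nonneg b))

variable {A : Type v} [CStarAlgebra A]

theorem MatPos.add {n : ℕ} {x y : Matrix (Fin n) (Fin n) A} (hx : MatPos x) (hy : MatPos y) :
    MatPos (x + y) := by
  let _ := CStarAlgebra.spectralOrder A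
  have := CStarAlgebra.spectralOrderedRing A
  obtain ⟨a, rfl⟩ := hx
  obtain ⟨b, rfl⟩ := hy
  obtain ⟨c, hc⟩ := CStarAlgebra.exists_star_mul_self_add
    (CStarMatrix.ofMatrix a) (CStarMatrix.ofMatrix b)
  exact ⟨CStarMatrix.ofMatrix.symm c, hc⟩

variable [PartialOrder A] [StarOrderedRing A]

/-- The Gram matrix of `k` elements of `A` is dominated by `k` times a diagonal bound of its
diagonal. -/
theorem matPos_diagonal_sub_gram {k : ℕ} (c : Fin k → A) (s : Fin k → ℝ)
    (hc : ∀ i, star (c i) * c i ≤ s i • 1) :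
    MatPos (Matrix.of fun i j => (if i = j then ((k : ℝ) * s i) • (1 : A) else 0) -
      star (c i) * c j) := by
  rcases Nat.eq_zero_or_pos k with rfl | hk
  · exact ⟨0, by ext i; exact i.elim0⟩
  have hk0 : (0 : ℝ) < k := by exact_mod_cast hk
  choose y hy using fun i => CStarAlgebra.nonneg_iff_eq_star_mul_self.1
    (smul_nonneg hk0.le (sub_nonneg.2 (hc i)))
  have h1 : MatPos (Matrix.diagonal fun i => star (y i) * y i) :=
    ⟨Matrix.diagonal y, by
      rw [Matrix.star_eq_conjTranspose, Matrix.diagonal_conjTranspose, Matrix.diagonal_mul_diagonal]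
      rfl⟩
  have h2 : MatPos (Matrix.of fun i j => (if i = j then (k : ℝ) • (star (c i) * c j) else 0) -
      star (c i) * c j) := by
    refine ⟨Matrix.of fun p i => √k • ((if p = i then c i else 0) - (k : ℝ)⁻¹ • c i), ?_⟩
    ext i j
    simp only [Matrix.star_eq_conjTranspose, Matrix.mul_apply, Matrix.conjTranspose_apply,
      Matrix.of_apply, star_smul, star_trivial, smul_mul_smul_comm, Real.mul_self_sqrt hk0.le,
      ← Finset.smul_sum]
    simp only [star_smul, star_trivial, star_sub, sub_mul, mul_sub, apply_ite star, star_zero,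
      ite_mul, mul_ite, zero_mul, mul_zero, smul_mul_assoc, mul_smul_comm, smul_sub, smul_ite,
      smul_zero, Finset.sum_sub_distrib, Finset.sum_ite_eq', Finset.mem_univ, if_true,
      Finset.sum_const, Finset.card_univ, Fintype.card_fin]
    rw [← Nat.cast_smul_eq_nsmul ℝ]
    by_cases h : i = j
    · subst h
      simp only [if_true]
      match_scalars
      field_simp
      ring
    · rw [if_neg h, if_neg (Ne.symm h)]
      match_scalars
      field_simp
      ring
  convert h1.add h2 using 1
  ext i j
  by_cases h : i = j
  · subst h
    simp [← hy, smul_sub, smul_smul]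
  · simp [h]

/-- If all combinations `∑ β i • r i` are bounded by the `ℓ²` norm of `β`, then
`k I - r* r` is `k`-block positive. -/
theorem matPos_conjAct_sub_gram {k n : ℕ} (r : Fin n → A) {C : ℝ}
    (hr : ∀ β : Fin n → ℂ, ‖∑ i, β i • r i‖ ^ 2 ≤ C * ∑ i, ‖β i‖ ^ 2)
    (α : Matrix (Fin n) (Fin k) ℂ) :
    MatPos (conjAct α (Matrix.of fun i j =>
      (if i = j then ((k : ℝ) * C) • (1 : A) else 0) - star (r i) * r j)) := by
  set x : Matrix (Fin n) (Fin n) A := Matrix.of fun i j =>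
      (if i = j then ((k : ℝ) * C) • (1 : A) else 0) - star (r i) * r j with hx
  have hentry : ∀ γ : Matrix (Fin n) (Fin k) ℂ, ∀ i j, conjAct γ x i j =
      ((k : ℝ) * C) • ((γᴴ * γ) i j • (1 : A)) -
        star (∑ p, γ p i • r p) * ∑ q, γ q j • r q := fun γ i j => by
    simp only [conjAct, hx, Matrix.of_apply, smul_sub, Finset.sum_sub_distrib, smul_ite, smul_zero,
      Finset.sum_ite_eq, Finset.mem_univ, if_true, Matrix.mul_apply, Matrix.conjTranspose_apply]
    congr 1
    · rw [Finset.sum_smul, Finset.smul_sum]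
      exact Finset.sum_congr rfl fun p _ => by rw [smul_comm]; rfl
    · rw [star_sum, Finset.sum_mul_sum]
      refine Finset.sum_congr rfl fun p _ => Finset.sum_congr rfl fun q _ => ?_
      rw [star_smul, smul_mul_smul_comm]
      rfl
  have hG : (αᴴ * α).IsHermitian := Matrix.isHermitian_conjTranspose_mul_self α
  set U := hG.eigenvectorUnitary
  have hdiag := hG.conjStarAlgAut_star_eigenvectorUnitary
  set γ : Matrix (Fin n) (Fin k) ℂ := α * (U : Matrix (Fin k) (Fin k) ℂ) with hγ
  have hγγ : γᴴ * γ = Matrix.diagonal (RCLike.ofReal ∘ hG.eigenvalues) := by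
    rw [← hdiag, Unitary.conjStarAlgAut_apply, hγ, Matrix.conjTranspose_mul]
    simp [Matrix.mul_assoc, Matrix.star_eq_conjTranspose, U]
  have hα : α = γ * star (U : Matrix (Fin k) (Fin k) ℂ) := by
    rw [hγ, Matrix.mul_assoc, Unitary.mul_star_self_of_mem U.2, Matrix.mul_one]
  rw [hα, conjAct_mul]
  refine MatPos.conjAct ?_ _
  have hnorm : ∀ i, ∑ p, ‖γ p i‖ ^ 2 = hG.eigenvalues i := fun i => by
    have := congrFun (congrFun hγγ i) i
    simp only [Matrix.mul_apply, Matrix.conjTranspose_apply, Matrix.diagonal_apply_eq,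
      Function.comp_apply] at this
    simp_rw [Complex.star_def, Complex.conj_mul'] at this
    exact Complex.ofReal_injective (by push_cast; exact this)
  convert matPos_diagonal_sub_gram (fun i => ∑ p, γ p i • r p) (fun i => C * hG.eigenvalues i)
    (fun i => ?_) using 1
  · ext i j
    rw [hentry, hγγ, Matrix.of_apply]
    congr 1
    by_cases h : i = j
    · subst h
      simp [mul_smul]
    · simp [h]
  · refine CStarAlgebra.star_mul_le_algebraMap_norm_sq.trans ?_
    rw [← hnorm, ← Algebra.algebraMap_eq_smul_one]
    exact algebraMap_mono A (hr _)

end MatrixPositivity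

section Dimension

variable {A : Type v} [CStarAlgebra A] [PartialOrder A] [StarOrderedRing A]

theorem MatPos.sum_nonneg {n : ℕ} {x : Matrix (Fin n) (Fin n) A} (hx : MatPos x) (v : Fin n → A) :
    0 ≤ ∑ i, ∑ j, star (v i) * x i j * v j := by
  obtain ⟨y, rfl⟩ := hx
  have : ∑ i, ∑ j, star (v i) * (star y * y) i j * v j =
      ∑ p, star (∑ i, y p i * v i) * ∑ j, y p j * v j := by
    simp only [Matrix.mul_apply, Matrix.star_apply, star_sum, star_mul,
      Finset.mul_sum, Finset.sum_mul]
    rw [Finset.sum_comm_cycle]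
    simp only [mul_assoc]
    exact Finset.sum_congr rfl fun _ _ => Finset.sum_comm
  rw [this]
  exact Finset.sum_nonneg fun p _ => star_mul_self_nonneg _

/-- A pure state on a `k`-minimal algebra admits no `k + 1` orthonormal vectors of the form
`π(a)ξ` in its GNS space. -/
theorem IsPureStateCstar.not_orthonormal {k : ℕ} (hmin : IsKMinimalCstar A k)
    {ρ : A →ₗ[ℂ] ℂ} (hρ : IsPureStateCstar ρ) (d : Fin (k + 1) → A)
    (hd : ∀ i j, ρ (star (d i) * d j) = if i = j then 1 else 0) : False := by
  set n : ℝ := k + 1 with hn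
  have hn1 : 1 ≤ n := by simp [hn]
  have hcard : ((Fintype.card (Fin (k + 1)) : ℕ) : ℝ) = n := by simp [hn]
  set ε : ℝ := 1 / (2 * n ^ 2) with hεdef
  have hε : 0 < ε := by positivity
  obtain ⟨e, he, hnorm, hexc⟩ := hρ.exists_excision
    (fun p : Fin (k + 1) × Fin (k + 1) => star (d p.1) * d p.2) hε
  have hee : ‖e * e‖ = 1 := by
    have := CStarRing.norm_star_mul_self (x := e)
    rwa [he.star_eq, hnorm, one_mul] at this
  let r : Fin (k + 1) → A := fun i => e * star (d i)
  let t : Fin (k + 1) → Fin (k + 1) → A := fun i j =>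
    r i * star (r j) - (if i = j then (1 : ℂ) else 0) • (e * e)
  have ht : ∀ i j, ‖t i j‖ ≤ ε := fun i j => by
    have := hexc (i, j)
    rw [hd] at this
    simpa [t, r, he.star_eq, mul_assoc] using this
  have hr : ∀ β : Fin (k + 1) → ℂ,
      ‖∑ i, β i • r i‖ ^ 2 ≤ (1 + n * ε) * ∑ i, ‖β i‖ ^ 2 := fun β => by
    have h1 : (∑ i, β i • r i) * star (∑ i, β i • r i) =
        (∑ i, β i * star (β i)) • (e * e) + ∑ i, ∑ j, (β i * star (β j)) • t i j := by
      rw [star_sum, Finset.sum_mul_sum, Finset.sum_smul, ← Finset.sum_add_distrib]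
      refine Finset.sum_congr rfl fun i _ => ?_
      simp only [t, smul_sub, Finset.sum_sub_distrib, star_smul, smul_mul_smul_comm, ite_smul,
        one_smul, zero_smul, smul_ite, smul_zero, Finset.sum_ite_eq, Finset.mem_univ, if_true]
      abel
    have h2 : ‖∑ i, ∑ j, (β i * star (β j)) • t i j‖ ≤ ε * (∑ i, ‖β i‖) ^ 2 := by
      rw [sq, Finset.sum_mul_sum, Finset.mul_sum]
      refine (norm_sum_le _ _).trans (Finset.sum_le_sum fun i _ => ?_)
      rw [Finset.mul_sum]
      refine (norm_sum_le _ _).trans (Finset.sum_le_sum fun j _ => ?_)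
      rw [norm_smul, norm_mul, norm_star, mul_comm ε]
      exact mul_le_mul_of_nonneg_left (ht i j) (by positivity)
    have h3 : (∑ i, ‖β i‖) ^ 2 ≤ n * ∑ i, ‖β i‖ ^ 2 := by
      have := sq_sum_le_card_mul_sum_sq (s := Finset.univ) (f := fun i => ‖β i‖)
      rwa [Finset.card_univ, hcard] at this
    have h4 : ‖(∑ i, β i * star (β i)) • (e * e)‖ ≤ ∑ i, ‖β i‖ ^ 2 := by
      rw [norm_smul, hee, mul_one]
      refine (norm_sum_le _ _).trans (le_of_eq (Finset.sum_congr rfl fun i _ => ?_))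
      rw [norm_mul, norm_star, sq]
    rw [sq, ← CStarRing.norm_self_mul_star, h1]
    have h5 := mul_le_mul_of_nonneg_left h3 hε.le
    refine (norm_add_le _ _).trans ?_
    linarith
  obtain hx := hmin (k + 1) (Matrix.of fun i j =>
      (if i = j then ((k : ℝ) * (1 + n * ε)) • (1 : A) else 0) - star (r i) * r j)
    (by
      ext i j
      by_cases h : i = j
      · subst h; simp
      · simp [h, Ne.symm h])
    (matPos_conjAct_sub_gram r hr)
  set K : ℝ := (k : ℝ) * (1 + n * ε) with hK
  set z : A := ∑ i, r i * star (r i) with hz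
  have hz0 : 0 ≤ z := Finset.sum_nonneg fun i _ => mul_star_self_nonneg _
  have hzz : z * z ≤ K • z := by
    have := hx.sum_nonneg fun i => star (r i)
    rw [← sub_nonneg]
    convert this using 1
    simp only [Matrix.of_apply, star_star, mul_sub, sub_mul, Finset.sum_sub_distrib, mul_ite,
      ite_mul, mul_zero, zero_mul, Finset.sum_ite_eq, Finset.mem_univ, if_true, hz,
      Finset.smul_sum, Finset.sum_mul_sum, mul_smul_comm, smul_mul_assoc, mul_one, mul_assoc]
  have hzsa : IsSelfAdjoint z := .of_nonneg hz0
  have hK0 : 0 ≤ K := by positivity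
  have h1 : ‖z‖ * ‖z‖ ≤ K * ‖z‖ := by
    rw [← CStarRing.norm_star_mul_self, hzsa.star_eq]
    refine (CStarAlgebra.norm_le_norm_of_nonneg_of_le ?_ hzz).trans ?_
    · simpa [hzsa.star_eq] using star_mul_self_nonneg z
    · rw [norm_smul, Real.norm_of_nonneg hK0]
  have h2 : n * (1 - ε) ≤ ‖z‖ := by
    have e1 : (n : ℝ) • (e * e) = z - ∑ i, t i i := by
      simp only [t, hz, if_true, one_smul, Finset.sum_sub_distrib, sub_sub_cancel,
        Finset.sum_const, Finset.card_univ]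
      rw [← Nat.cast_smul_eq_nsmul ℝ, hcard]
    have e2 : ‖∑ i, t i i‖ ≤ n * ε := by
      refine (norm_sum_le_of_le _ fun i _ => ht i i).trans ?_
      simp [hn]
    have e3 : n ≤ ‖z‖ + ‖∑ i, t i i‖ := by
      have := norm_sub_le z (∑ i, t i i)
      rwa [← e1, norm_smul, hee, mul_one, Real.norm_of_nonneg (by positivity)] at this
    linarith
  have hεn : n ^ 2 * ε = 1 / 2 := by rw [hεdef]; field_simp
  have hk : (k : ℝ) = n - 1 := by simp [hn]
  have hnε : n * ε ≤ 1 / 2 := by nlinarith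
  have hzpos : 0 < ‖z‖ := by linarith
  have h3 : ‖z‖ ≤ K := le_of_mul_le_mul_right h1 hzpos
  rw [hK, hk] at h3
  nlinarith

end Dimension

section GNS

open scoped InnerProductSpace

/-- If every orthonormal family in a dense subspace has at most `k` members, then the ambient
Hilbert space has dimension at most `k`. -/
theorem finrank_le_of_dense_of_not_orthonormal {H : Type*} [NormedAddCommGroup H]
    [InnerProductSpace ℂ H] {k : ℕ} (V : Submodule ℂ H) (hV : Dense (V : Set H))
    (h : ∀ w : Fin (k + 1) → V, ¬ Orthonormal ℂ w) :
    FiniteDimensional ℂ H ∧ Module.finrank ℂ H ≤ k := by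
  have hlt : Module.rank ℂ V < (k + 1 : ℕ) := by
    by_contra! hle
    obtain ⟨v, hv⟩ := Module.le_rank_iff.1 hle
    exact h _ (InnerProductSpace.gramSchmidtNormed_orthonormal hv)
  have hfin : FiniteDimensional ℂ V :=
    Module.rank_lt_aleph0_iff.1 (hlt.trans (Cardinal.natCast_lt_aleph0))
  have htop : V = ⊤ := by
    rw [← V.closed_of_finiteDimensional.submodule_topologicalClosure_eq]
    exact (Submodule.dense_iff_topologicalClosure_eq_top).1 hV
  subst htop
  refine ⟨(Module.finite_def.2 (Module.Finite.iff_fg.1 hfin)), ?_⟩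
  rw [← finrank_top]
  rw [← Module.finrank_eq_rank, Nat.cast_lt] at hlt
  exact Nat.lt_succ_iff.1 hlt

variable {A : Type v} [CStarAlgebra A] [PartialOrder A] [StarOrderedRing A]

namespace PositiveLinearMap

variable (f : A →ₚ[ℂ] ℂ)

/-- The canonical linear map from a C⋆-algebra to the GNS space of a positive functional. -/
def toGNS : A →ₗ[ℂ] f.GNS :=
  (UniformSpace.Completion.toComplL (𝕜 := ℂ) (E := f.PreGNS)).toLinearMap ∘ₗ f.toPreGNS.toLinearMap

theorem toGNS_apply (a : A) : f.toGNS a = (f.toPreGNS a : f.GNS) := rfl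

theorem inner_toGNS (a b : A) : ⟪f.toGNS a, f.toGNS b⟫_ℂ = f (star a * b) := by
  rw [toGNS_apply, toGNS_apply, UniformSpace.Completion.inner_coe, preGNS_inner_def]
  simp

theorem denseRange_toGNS : DenseRange f.toGNS :=
  UniformSpace.Completion.denseRange_coe.comp f.toPreGNS.surjective.denseRange
    (UniformSpace.Completion.continuous_coe _)

theorem gnsStarAlgHom_toGNS (a b : A) : f.gnsStarAlgHom a (f.toGNS b) = f.toGNS (a * b) := by
  simp [toGNS_apply]

end PositiveLinearMap

theorem IsPureStateCstar.finrank_gns_le {k : ℕ} (hmin : IsKMinimalCstar A k)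
    {ρ : A →ₗ[ℂ] ℂ} (hρ : IsPureStateCstar ρ) :
    FiniteDimensional ℂ hρ.1.toPositive.GNS ∧ Module.finrank ℂ hρ.1.toPositive.GNS ≤ k := by
  refine finrank_le_of_dense_of_not_orthonormal (LinearMap.range hρ.1.toPositive.toGNS)
    (by rw [LinearMap.coe_range]; exact hρ.1.toPositive.denseRange_toGNS) fun w hw => ?_
  choose d hd using fun i => (w i).2
  refine hρ.not_orthonormal hmin d fun i j => ?_
  rw [← orthonormal_iff_ite.1 hw i j, Submodule.coe_inner, ← hd, ← hd,
    PositiveLinearMap.inner_toGNS, IsStateCstar.toPositive_apply]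

theorem IsPureStateCstar.exists_gns {k : ℕ} (hmin : IsKMinimalCstar A k)
    {ρ : A →ₗ[ℂ] ℂ} (hρ : IsPureStateCstar ρ) :
    ∃ d : ℕ, d ≤ k ∧
      ∃ (π : A →⋆ₐ[ℂ] (EuclideanSpace ℂ (Fin d) →L[ℂ] EuclideanSpace ℂ (Fin d)))
        (ξ : EuclideanSpace ℂ (Fin d)),
        ‖ξ‖ = 1 ∧ Dense (Set.range fun a : A => π a ξ) ∧
        ∀ a : A, ρ a = ⟪ξ, π a ξ⟫_ℂ := by
  obtain ⟨hfin, hle⟩ := hρ.finrank_gns_le hmin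
  set f := hρ.1.toPositive
  have hf (a : A) : f a = ρ a := hρ.1.toPositive_apply a
  let e := (stdOrthonormalBasis ℂ f.GNS).repr
  let π : A →⋆ₐ[ℂ] (EuclideanSpace ℂ (Fin (Module.finrank ℂ f.GNS)) →L[ℂ]
      EuclideanSpace ℂ (Fin (Module.finrank ℂ f.GNS))) :=
    (e.conjStarAlgEquiv : (f.GNS →L[ℂ] f.GNS) →⋆ₐ[ℂ] _).comp f.gnsStarAlgHom
  have hπ (a : A) : π a (e (f.toGNS 1)) = e (f.toGNS a) := by
    simp [π, f.gnsStarAlgHom_toGNS, -PositiveLinearMap.gnsStarAlgHom_apply]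
  refine ⟨_, hle, π, e (f.toGNS 1), ?_, ?_, fun a => ?_⟩
  · rw [e.norm_map, @norm_eq_sqrt_re_inner ℂ, f.inner_toGNS, hf]
    simp [hρ.1.1]
  · simp only [hπ]
    exact e.surjective.denseRange.comp f.denseRange_toGNS e.continuous
  · rw [hπ, e.inner_map_map, f.inner_toGNS, hf]
    simp

end GNS

open scoped InnerProductSpace

/-- The GNS representation of a pure state on a `k`-minimal unital
C*-algebra acts on a Hilbert space of dimension at most `k`: there are `d ≤ k`, a unital
`*`-homomorphism `π : A → B(ℂ^d)` and a cyclic unit vector `ξ` with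
`ρ(a) = ⟨π(a)ξ, ξ⟩` for all `a`. -/
theorem stmt_16 {A : Type v} [NormedRing A] [StarRing A] [CStarRing A] [CompleteSpace A]
    [NormedAlgebra ℂ A] [StarModule ℂ A]
    (k : ℕ) (hk : 0 < k) (hmin : IsKMinimalCstar A k)
    (ρ : A →ₗ[ℂ] ℂ) (hρ : IsPureStateCstar ρ) :
    ∃ d : ℕ, d ≤ k ∧
      ∃ (π : A →⋆ₐ[ℂ] (EuclideanSpace ℂ (Fin d) →L[ℂ] EuclideanSpace ℂ (Fin d)))
        (ξ : EuclideanSpace ℂ (Fin d)),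
        ‖ξ‖ = 1 ∧ Dense (Set.range fun a : A => π a ξ) ∧
        ∀ a : A, ρ a = ⟪ξ, π a ξ⟫_ℂ := by
  let _ : CStarAlgebra A := { }
  let _ : PartialOrder A := CStarAlgebra.spectralOrder A
  have _ : StarOrderedRing A := CStarAlgebra.spectralOrderedRing A
  exact hρ.exists_gns hmin
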